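/- arXiv:2004.09707 — 5 statements merged into one kernel-verified Lean document; each statement's English description precedes it below -/
import Mathlib

section
/- Let Θ be a continuous ellipsoid cover of ℝⁿ and fix t ∈ ℝ. Then there exists a bounded continuous function r : ℝⁿ → (0,∞) such that the Euclidean ball B(x, r(x)) is contained in θ_{x,t} for every x ∈ ℝⁿ. -/
open MeasureTheory Metric Set Filter ENNReal
noncomputable section

abbrev Euc (n : ℕ) : Type := EuclideanSpace ℝ (Fin n)

structure EllipsoidCover (n : ℕ) where
  M : Euc n → ℝ → (Euc n ≃L[ℝ] Euc n)
  a₁ : ℝ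
  a₂ : ℝ
  a₃ : ℝ
  a₄ : ℝ
  a₅ : ℝ
  a₆ : ℝ
  ha₁ : 0 < a₁
  ha₂ : 0 < a₂
  ha₃ : 0 < a₃
  ha₄ : 0 < a₄
  ha₅ : 0 < a₅
  ha₆ : 0 < a₆
  volume_lb : ∀ (x : Euc n) (t : ℝ),
    a₁ * 2 ^ (-t) ≤ (volume ((fun y => M x t y + x) '' ball 0 1)).toReal
  volume_ub : ∀ (x : Euc n) (t : ℝ),
    (volume ((fun y => M x t y + x) '' ball 0 1)).toReal ≤ a₂ * 2 ^ (-t)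
  shape : ∀ (x y : Euc n) (t s : ℝ), 0 ≤ s →
    (((fun v => M x t v + x) '' ball 0 1) ∩ ((fun v => M y (t + s) v + y) '' ball 0 1)).Nonempty →
    a₃ * 2 ^ (-(a₄ * s)) ≤
        1 / ‖((M y (t + s)).symm : Euc n →L[ℝ] Euc n).comp (M x t : Euc n →L[ℝ] Euc n)‖ ∧
    1 / ‖((M y (t + s)).symm : Euc n →L[ℝ] Euc n).comp (M x t : Euc n →L[ℝ] Euc n)‖ ≤
        ‖((M x t).symm : Euc n →L[ℝ] Euc n).comp (M y (t + s) : Euc n →L[ℝ] Euc n)‖ ∧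
    ‖((M x t).symm : Euc n →L[ℝ] Euc n).comp (M y (t + s) : Euc n →L[ℝ] Euc n)‖ ≤
        a₅ * 2 ^ (-(a₆ * s))

namespace EllipsoidCover

variable {n : ℕ}

def θ (Θ : EllipsoidCover n) (x : Euc n) (t : ℝ) : Set (Euc n) :=
  (fun y => Θ.M x t y + x) '' ball 0 1

def dil (Θ : EllipsoidCover n) (x : Euc n) (t : ℝ) (lam : ℝ) : Set (Euc n) :=
  (fun y => lam • (Θ.M x t y) + x) '' ball 0 1

def ρ (Θ : EllipsoidCover n) (x y : Euc n) : ℝ :=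
  sInf {r : ℝ | ∃ (z : Euc n) (t : ℝ), x ∈ Θ.θ z t ∧ y ∈ Θ.θ z t ∧ r = (volume (Θ.θ z t)).toReal}

end EllipsoidCover

namespace EllipsoidCover

variable {n : ℕ}

theorem ball_subset_θ (Θ : EllipsoidCover n) (x : Euc n) (t : ℝ) {r : ℝ}
    (hr : r ≤ 1 / (‖((Θ.M x t).symm : Euc n →L[ℝ] Euc n)‖ + 1)) :
    ball x r ⊆ Θ.θ x t := by
  intro z hz
  refine ⟨(Θ.M x t).symm (z - x), ?_, by simp⟩
  have hz' : ‖z - x‖ < r := by rwa [mem_ball, dist_eq_norm] at hz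
  have hop : ‖(Θ.M x t).symm (z - x)‖ ≤
      ‖((Θ.M x t).symm : Euc n →L[ℝ] Euc n)‖ * ‖z - x‖ :=
    ((Θ.M x t).symm : Euc n →L[ℝ] Euc n).le_opNorm (z - x)
  have hK := norm_nonneg ((Θ.M x t).symm : Euc n →L[ℝ] Euc n)
  have hlt : ‖z - x‖ * (‖((Θ.M x t).symm : Euc n →L[ℝ] Euc n)‖ + 1) < 1 :=
    (lt_div_iff₀ (by positivity)).1 (hz'.trans_le hr)
  rw [mem_ball_zero_iff]
  nlinarith [norm_nonneg (z - x)]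

theorem center_mem_θ (Θ : EllipsoidCover n) (x : Euc n) (t : ℝ) : x ∈ Θ.θ x t :=
  ⟨0, by simp, by simp⟩

theorem norm_symm_le_of_mem_θ (Θ : EllipsoidCover n) {x y : Euc n} {t : ℝ}
    (hy : y ∈ Θ.θ x t) :
    ‖((Θ.M y t).symm : Euc n →L[ℝ] Euc n)‖ ≤
      1 / Θ.a₃ * ‖((Θ.M x t).symm : Euc n →L[ℝ] Euc n)‖ := by
  have h := (Θ.shape x y t 0 le_rfl
    ⟨y, hy, by rw [add_zero]; exact Θ.center_mem_θ y t⟩).1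
  simp only [add_zero, mul_zero, neg_zero, Real.rpow_zero, mul_one] at h
  set T := ((Θ.M y t).symm : Euc n →L[ℝ] Euc n).comp (Θ.M x t : Euc n →L[ℝ] Euc n) with hT
  have hpos : 0 < ‖T‖ := one_div_pos.1 (Θ.ha₃.trans_le h)
  have hTle : ‖T‖ ≤ 1 / Θ.a₃ := (le_one_div Θ.ha₃ hpos).1 h
  have hfac : ((Θ.M y t).symm : Euc n →L[ℝ] Euc n) =
      T.comp ((Θ.M x t).symm : Euc n →L[ℝ] Euc n) := by
    apply ContinuousLinearMap.ext
    intro v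
    simp [hT]
  rw [hfac]
  exact (T.opNorm_comp_le _).trans (mul_le_mul_of_nonneg_right hTle (norm_nonneg _))

end EllipsoidCover

/-- Given a continuous ellipsoid cover `Θ` of `ℝⁿ` and a fixed scale `t`,
there is a bounded continuous function `r : ℝⁿ → (0, ∞)` such that the Euclidean ball
`B(x, r x)` is contained in the ellipsoid `θ_{x,t}` for every `x`. -/
theorem stmt1 (n : ℕ) (Θ : EllipsoidCover n) (t : ℝ) :
    ∃ r : Euc n → ℝ, Continuous r ∧ BddAbove (Set.range r) ∧
      ∀ x : Euc n, 0 < r x ∧ Metric.ball x (r x) ⊆ Θ.θ x t := by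
  let K : Euc n → ℝ := fun x => ‖((Θ.M x t).symm : Euc n →L[ℝ] Euc n)‖
  have hK : ∀ x, 0 ≤ K x := fun x => norm_nonneg _
  obtain ⟨r, hr⟩ := exists_continuous_forall_mem_convex_of_local_const
    (t := fun x => Set.Ioc (0 : ℝ) (1 / (K x + 1))) (fun x => convex_Ioc _ _) (by
      intro x
      have ha := Θ.ha₃
      have hx := hK x
      refine ⟨1 / (1 / Θ.a₃ * K x + 1), ?_⟩
      filter_upwards [ball_mem_nhds x (show 0 < 1 / (K x + 1) by positivity)] with y hy
      refine ⟨by positivity, one_div_le_one_div_of_le (by linarith [hK y]) ?_⟩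
      exact add_le_add_left (Θ.norm_symm_le_of_mem_θ (Θ.ball_subset_θ x t le_rfl hy)) 1)
  refine ⟨r, r.continuous, ⟨1, ?_⟩, fun x => ⟨(hr x).1, Θ.ball_subset_θ x t (hr x).2⟩⟩
  rintro _ ⟨x, rfl⟩
  exact (hr x).2.trans ((div_le_one (by linarith [hK x])).2 (by linarith [hK x]))
end
end

section
/- Let Θ be a continuous ellipsoid cover of ℝⁿ, let N, Ñ ∈ ℕ₀ with N ≤ Ñ, and let r > 0. Then for every tempered distribution f ∈ S'(ℝⁿ) and every x ∈ ℝⁿ, M°_{N,Ñ}f(x) ≤ M^r_{N,Ñ}f(x) ≤ (1+r)^Ñ · M°_{N,Ñ}f(x). -/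
open MeasureTheory Metric Set Filter ENNReal
noncomputable section

/-- The condition `‖φ‖_{N,Nt} ≤ 1`: all multi-index partial derivatives of order `≤ N`
(encoded as iterated directional derivatives along coordinate directions), weighted by
`(1+|y|)^Nt`, are bounded by `1`. -/
def SchwartzCond (n N Nt : ℕ) (φ : SchwartzMap (Euc n) ℝ) : Prop :=
  ∀ k : ℕ, k ≤ N → ∀ v : Fin k → Fin n, ∀ y : Euc n,
    (1 + ‖y‖) ^ Nt *
      |iteratedFDeriv ℝ k (⇑φ) y (fun j => EuclideanSpace.single (v j) (1 : ℝ))| ≤ 1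

/-- `dilKer Θ φ x t y z = φ_{x,t}(y − z)`, where
`φ_{x,t}(w) := |det M_{x,t}|⁻¹ φ(M_{x,t}⁻¹ w)`. -/
def dilKer {n : ℕ} (Θ : EllipsoidCover n) (φ : SchwartzMap (Euc n) ℝ)
    (x : Euc n) (t : ℝ) (y z : Euc n) : ℝ :=
  |LinearMap.det ((Θ.M x t : Euc n →L[ℝ] Euc n) : Euc n →ₗ[ℝ] Euc n)|⁻¹ *
    φ ((Θ.M x t).symm (y - z))

/-- The radial grand maximal function `M°_{N,Nt} f(x)` of a tempered distribution `f`,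
with values in `ℝ≥0∞`: the supremum of `|⟨f, φ_{x,t}(x − ·)⟩|` over `t ∈ ℝ` and
`φ ∈ S_{N,Nt}`. -/
def Mrad {n : ℕ} (Θ : EllipsoidCover n) (N Nt : ℕ)
    (f : SchwartzMap (Euc n) ℝ →L[ℝ] ℝ) (x : Euc n) : ℝ≥0∞ :=
  sSup {r : ℝ≥0∞ | ∃ (φ ψ : SchwartzMap (Euc n) ℝ) (t : ℝ), SchwartzCond n N Nt φ ∧
    (∀ z : Euc n, ψ z = dilKer Θ φ x t x z) ∧ r = ENNReal.ofReal |f ψ|}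

/-- The nontangential grand maximal function `M^r_{N,Nt} f(x)` with aperture `r`,
with values in `ℝ≥0∞`: the supremum of `|⟨f, φ_{x,t}(y − ·)⟩|` over `t ∈ ℝ`,
`y ∈ r θ_{x,t}` and `φ ∈ S_{N,Nt}`. -/
def Mnt {n : ℕ} (Θ : EllipsoidCover n) (N Nt : ℕ) (rap : ℝ)
    (f : SchwartzMap (Euc n) ℝ →L[ℝ] ℝ) (x : Euc n) : ℝ≥0∞ :=
  sSup {r : ℝ≥0∞ | ∃ (φ ψ : SchwartzMap (Euc n) ℝ) (t : ℝ) (y : Euc n),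
    SchwartzCond n N Nt φ ∧ y ∈ Θ.dil x t rap ∧
    (∀ z : Euc n, ψ z = dilKer Θ φ x t y z) ∧ r = ENNReal.ofReal |f ψ|}

/-- The translate of `φ` by a vector of norm at most `r`, divided by `(1 + r) ^ Nt`, satisfies the
same normalization as `φ`. -/
theorem SchwartzCond.smul_translate {n N Nt : ℕ} {φ φ' : SchwartzMap (Euc n) ℝ}
    (hφ : SchwartzCond n N Nt φ) {r : ℝ} (hr : 0 ≤ r) {a : Euc n} (ha : ‖a‖ ≤ r)
    (hφ' : ∀ w, φ' w = ((1 + r) ^ Nt)⁻¹ * φ (w + a)) :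
    SchwartzCond n N Nt φ' := by
  intro k hk v y
  have hcoe : (⇑φ' : Euc n → ℝ) = ((1 + r) ^ Nt)⁻¹ • fun w => φ (w + a) := by
    ext w
    simp [hφ' w]
  have hsmooth : ContDiff ℝ k fun w => φ (w + a) :=
    (φ.smooth k).comp (contDiff_id.add contDiff_const)
  have hr' : 0 < (1 + r) ^ Nt := by positivity
  have hweight : (1 + ‖y‖) ^ Nt ≤ (1 + r) ^ Nt * (1 + ‖y + a‖) ^ Nt := by
    rw [← mul_pow]
    have htri : ‖y‖ ≤ ‖y + a‖ + ‖a‖ := norm_le_add_norm_add y a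
    gcongr
    nlinarith [norm_nonneg (y + a)]
  rw [hcoe, iteratedFDeriv_const_smul_apply hsmooth.contDiffAt, iteratedFDeriv_comp_add_right,
    _root_.smul_apply, smul_eq_mul, abs_mul, abs_of_pos (inv_pos.2 hr')]
  refine le_trans (mul_le_mul_of_nonneg_right hweight (by positivity)) ?_
  refine le_trans (le_of_eq ?_) (hφ k hk v (y + a))
  field_simp

theorem Mrad_le_Mnt {n : ℕ} (Θ : EllipsoidCover n) (N Nt : ℕ) (r : ℝ)
    (f : SchwartzMap (Euc n) ℝ →L[ℝ] ℝ) (x : Euc n) :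
    Mrad Θ N Nt f x ≤ Mnt Θ N Nt r f x := by
  refine sSup_le_sSup ?_
  rintro _ ⟨φ, ψ, t, hφ, hψ, rfl⟩
  exact ⟨φ, ψ, t, x, hφ, ⟨0, by simp, by simp⟩, hψ, rfl⟩

theorem Mnt_le_mul_Mrad {n : ℕ} (Θ : EllipsoidCover n) (N Nt : ℕ) {r : ℝ} (hr : 0 ≤ r)
    (f : SchwartzMap (Euc n) ℝ →L[ℝ] ℝ) (x : Euc n) :
    Mnt Θ N Nt r f x ≤ ENNReal.ofReal ((1 + r) ^ Nt) * Mrad Θ N Nt f x := by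
  refine sSup_le ?_
  rintro _ ⟨φ, ψ, t, _, hφ, ⟨u, hu, rfl⟩, hψ, rfl⟩
  have hr' : 0 < (1 + r) ^ Nt := by positivity
  have hu' : ‖r • u‖ ≤ r := by
    rw [norm_smul, Real.norm_of_nonneg hr]
    exact mul_le_of_le_one_right hr (mem_ball_zero_iff.1 hu).le
  let φ' : SchwartzMap (Euc n) ℝ :=
    ((1 + r) ^ Nt)⁻¹ • SchwartzMap.compSubConstCLM ℝ (-(r • u)) φ
  have hφ' : ∀ w, φ' w = ((1 + r) ^ Nt)⁻¹ * φ (w + r • u) := fun w => by simp [φ']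
  have hmem : ENNReal.ofReal |f (((1 + r) ^ Nt)⁻¹ • ψ)| ≤ Mrad Θ N Nt f x := by
    refine le_sSup ⟨φ', _, t, hφ.smul_translate hr hu' hφ', fun z => ?_, rfl⟩
    have harg : (Θ.M x t).symm (r • Θ.M x t u + x - z) = (Θ.M x t).symm (x - z) + r • u := by
      rw [add_sub_assoc, map_add, map_smul, ContinuousLinearEquiv.symm_apply_apply, add_comm]
    simp only [_root_.smul_apply, hψ, dilKer, hφ', harg, smul_eq_mul]
    ring
  calc ENNReal.ofReal |f ψ|
      = ENNReal.ofReal ((1 + r) ^ Nt) * ENNReal.ofReal |f (((1 + r) ^ Nt)⁻¹ • ψ)| := by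
        rw [← ENNReal.ofReal_mul hr'.le, map_smul, smul_eq_mul, abs_mul,
          abs_of_pos (inv_pos.2 hr'), mul_inv_cancel_left₀ hr'.ne']
    _ ≤ _ := by gcongr

/-- For `N ≤ Ñ` and aperture `r > 0`, the radial and nontangential
grand maximal functions are pointwise equivalent:
`M°_{N,Ñ} f(x) ≤ M^r_{N,Ñ} f(x) ≤ (1+r)^Ñ · M°_{N,Ñ} f(x)` for every tempered
distribution `f` and every `x`. -/
theorem stmt7 (n : ℕ) (Θ : EllipsoidCover n) (N Nt : ℕ) (hNNt : N ≤ Nt)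
    (r : ℝ) (hr : 0 < r) (f : SchwartzMap (Euc n) ℝ →L[ℝ] ℝ) (x : Euc n) :
    Mrad Θ N Nt f x ≤ Mnt Θ N Nt r f x ∧
    Mnt Θ N Nt r f x ≤ ENNReal.ofReal ((1 + r) ^ Nt) * Mrad Θ N Nt f x :=
  ⟨Mrad_le_Mnt Θ N Nt r f x, Mnt_le_mul_Mrad Θ N Nt hr.le f x⟩
end
end

section
/- Let Θ be a continuous ellipsoid cover of ℝⁿ that is pointwise continuous, i.e., for every t ∈ ℝ the map x ↦ M_{x,t} is continuous in the matrix norm. Let N, Ñ ∈ ℕ₀ with N ≤ Ñ, let f ∈ S'(ℝⁿ), and let λ > 0. Then the superlevel set Ω := {x ∈ ℝⁿ : M°_{N,Ñ}f(x) > λ} is an open subset of ℝⁿ. -/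
open MeasureTheory Metric Set Filter ENNReal
noncomputable section

open scoped SchwartzMap in
/-- A family of Schwartz functions depends continuously on its parameter as soon as all its
derivatives are jointly continuous and satisfy locally uniform Schwartz bounds. -/
theorem SchwartzMap.continuous_of_continuous_iteratedFDeriv {X E F : Type*} [TopologicalSpace X]
    [NormedAddCommGroup E] [NormedSpace ℝ E] [ProperSpace E]
    [NormedAddCommGroup F] [NormedSpace ℝ F] (Ψ : X → 𝓢(E, F))
    (hcont : ∀ l, Continuous fun p : X × E => iteratedFDeriv ℝ l (Ψ p.1) p.2)
    (hbound : ∀ k l x₀, ∃ C : ℝ, ∀ᶠ x in nhds x₀, ∀ z,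
      ‖z‖ ^ k * ‖iteratedFDeriv ℝ l (Ψ x) z‖ ≤ C) :
    Continuous Ψ := by
  rw [continuous_iff_continuousAt]
  intro x₀
  refine ((schwartz_withSeminorms ℝ E F).tendsto_nhds Ψ (Ψ x₀)).2 ?_
  rintro ⟨k, l⟩ ε hε
  obtain ⟨C, hC⟩ := hbound (k + 1) l x₀
  set R : ℝ := 4 * |C| / ε + 1 with hR
  have hR0 : 0 < R := by positivity
  have hnear : ∀ᶠ x in nhds x₀, ∀ z ∈ closedBall (0 : E) R,
      ‖z‖ ^ k * ‖iteratedFDeriv ℝ l (Ψ x) z - iteratedFDeriv ℝ l (Ψ x₀) z‖ < ε / 2 := by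
    refine (isCompact_closedBall (0 : E) R).eventually_forall_of_forall_eventually
      (P := fun x z => ‖z‖ ^ k * ‖iteratedFDeriv ℝ l (Ψ x) z - iteratedFDeriv ℝ l (Ψ x₀) z‖
        < ε / 2) fun z _ => ?_
    have h1 := hcont l
    have h2 : Continuous fun p : X × E => iteratedFDeriv ℝ l (Ψ x₀) p.2 :=
      (hcont l).comp (continuous_const.prodMk continuous_snd)
    have h3 : Continuous fun p : X × E =>
        ‖p.2‖ ^ k * ‖iteratedFDeriv ℝ l (Ψ p.1) p.2 - iteratedFDeriv ℝ l (Ψ x₀) p.2‖ := by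
      fun_prop
    exact h3.continuousAt.eventually_lt continuousAt_const (by simpa using half_pos hε)
  filter_upwards [hnear, hC] with x hx hCx
  have hCx₀ := hC.self_of_nhds
  refine (SchwartzMap.seminorm_le_bound ℝ k l _ (half_pos hε).le fun z => ?_).trans_lt
    (half_lt_self hε)
  have hsub : iteratedFDeriv ℝ l (⇑(Ψ x - Ψ x₀)) z
      = iteratedFDeriv ℝ l (Ψ x) z - iteratedFDeriv ℝ l (Ψ x₀) z := by
    have := iteratedFDeriv_sub_apply (x := z) ((Ψ x).smooth l).contDiffAt
      ((Ψ x₀).smooth l).contDiffAt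
    exact this
  rw [hsub]
  rcases le_or_gt ‖z‖ R with hz | hz
  · exact (hx z (by simpa using hz)).le
  · have hA : ‖z‖ * (‖z‖ ^ k * ‖iteratedFDeriv ℝ l (Ψ x) z - iteratedFDeriv ℝ l (Ψ x₀) z‖)
        ≤ 2 * |C| := by
      calc _ ≤ ‖z‖ * (‖z‖ ^ k *
              (‖iteratedFDeriv ℝ l (Ψ x) z‖ + ‖iteratedFDeriv ℝ l (Ψ x₀) z‖)) := by
            gcongr
            exact norm_sub_le _ _
        _ = ‖z‖ ^ (k + 1) * ‖iteratedFDeriv ℝ l (Ψ x) z‖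
            + ‖z‖ ^ (k + 1) * ‖iteratedFDeriv ℝ l (Ψ x₀) z‖ := by ring
        _ ≤ 2 * |C| := by linarith [hCx z, hCx₀ z, le_abs_self C]
    have hRε : 2 * |C| ≤ R * (ε / 2) := by
      have : R * (ε / 2) = 2 * |C| + ε / 2 := by
        rw [hR]; field_simp; ring
      linarith
    by_contra! hlt
    have := mul_lt_mul'' hz hlt hR0.le (half_pos hε).le
    linarith

/-- Inversion is continuous along a continuous family of invertible operators. -/
theorem ContinuousLinearEquiv.continuous_coe_symm {X E : Type*} [TopologicalSpace X]
    [NormedAddCommGroup E] [NormedSpace ℝ E] [CompleteSpace E] (M : X → E ≃L[ℝ] E)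
    (hM : Continuous fun x => (M x : E →L[ℝ] E)) :
    Continuous fun x => ((M x).symm : E →L[ℝ] E) := by
  rw [continuous_iff_continuousAt]
  intro x
  have h := (contDiffAt_map_inverse (𝕜 := ℝ) (n := 0) (M x)).continuousAt.comp
    (f := fun x => (M x : E →L[ℝ] E)) hM.continuousAt
  simpa [Function.comp_def] using h

open scoped SchwartzMap in
/-- The Schwartz function `z ↦ φ (M⁻¹ (c - z))`. -/
def SchwartzMap.reflectDilate {E F : Type*} [NormedAddCommGroup E] [NormedSpace ℝ E]
    [NormedAddCommGroup F] [NormedSpace ℝ F] (φ : 𝓢(E, F)) (M : E ≃L[ℝ] E) (c : E) : 𝓢(E, F) :=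
  compSubConstCLM ℝ c
    (compCLMOfContinuousLinearEquiv ℝ (M.symm.trans (ContinuousLinearEquiv.neg ℝ)) φ)

open scoped SchwartzMap in
theorem SchwartzMap.reflectDilate_apply {E F : Type*} [NormedAddCommGroup E] [NormedSpace ℝ E]
    [NormedAddCommGroup F] [NormedSpace ℝ F] (φ : 𝓢(E, F)) (M : E ≃L[ℝ] E) (c z : E) :
    φ.reflectDilate M c z = φ (M.symm (c - z)) := by
  simp [reflectDilate]

open scoped SchwartzMap in
theorem SchwartzMap.iteratedFDeriv_reflectDilate {E F : Type*} [NormedAddCommGroup E]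
    [NormedSpace ℝ E] [NormedAddCommGroup F] [NormedSpace ℝ F] (φ : 𝓢(E, F)) (M : E ≃L[ℝ] E)
    (c z : E) (l : ℕ) :
    iteratedFDeriv ℝ l (φ.reflectDilate M c) z =
      (iteratedFDeriv ℝ l φ (M.symm (c - z))).compContinuousLinearMap
        fun _ => -(M.symm : E →L[ℝ] E) := by
  have h : ⇑(φ.reflectDilate M c) = fun z => (φ ∘ ⇑(-(M.symm : E →L[ℝ] E))) (z - c) := by
    ext z
    simp [reflectDilate_apply]
  rw [h, iteratedFDeriv_comp_sub,
    ContinuousLinearMap.iteratedFDeriv_comp_right _ (φ.smooth l) _ le_rfl]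
  simp

open scoped SchwartzMap in
theorem SchwartzMap.continuous_reflectDilate {X E F : Type*} [TopologicalSpace X]
    [NormedAddCommGroup E] [NormedSpace ℝ E] [ProperSpace E]
    [NormedAddCommGroup F] [NormedSpace ℝ F] (φ : 𝓢(E, F)) (M : X → E ≃L[ℝ] E) (c : X → E)
    (hM : Continuous fun x => (M x : E →L[ℝ] E)) (hc : Continuous c) :
    Continuous fun x => φ.reflectDilate (M x) (c x) := by
  have hL := ContinuousLinearEquiv.continuous_coe_symm M hM
  apply continuous_of_continuous_iteratedFDeriv
  · intro l
    simp only [iteratedFDeriv_reflectDilate]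
    have hφ : Continuous (iteratedFDeriv ℝ l φ) := (φ.smooth l).continuous_iteratedFDeriv le_rfl
    have hw : Continuous fun p : X × E => (M p.1).symm (c p.1 - p.2) := by
      have : Continuous fun p : X × E => ((M p.1).symm : E →L[ℝ] E) (c p.1 - p.2) :=
        (hL.comp continuous_fst).clm_apply ((hc.comp continuous_fst).sub continuous_snd)
      exact this
    have hcomp : Continuous fun p : X × E =>
        ContinuousMultilinearMap.compContinuousLinearMapContinuousMultilinear ℝ
          (fun _ : Fin l => E) (fun _ : Fin l => E) F
          (fun _ => -((M p.1).symm : E →L[ℝ] E)) := by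
      refine (ContinuousMultilinearMap.cont _).comp (continuous_pi fun _ => ?_)
      exact (hL.comp continuous_fst).neg
    exact hcomp.clm_apply (hφ.comp hw)
  · intro k l x₀
    set m : ℝ := 2 ^ k * (Finset.Iic (k, l)).sup (fun m => SchwartzMap.seminorm ℝ m.1 m.2) φ
    set A : X → ℝ := fun x => ‖c x‖ + ‖(M x : E →L[ℝ] E)‖
    set B : X → ℝ := fun x => ‖((M x).symm : E →L[ℝ] E)‖
    have hAB : Continuous fun x => A x ^ k * B x ^ l * m := by fun_prop
    refine ⟨A x₀ ^ k * B x₀ ^ l * m + 1, ?_⟩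
    filter_upwards [hAB.continuousAt.eventually_lt continuousAt_const
      (lt_add_one (A x₀ ^ k * B x₀ ^ l * m))] with x hx z
    refine le_trans ?_ hx.le
    set w := (M x).symm (c x - z) with hw
    have hz : ‖z‖ ≤ A x * (1 + ‖w‖) := by
      have hzw : z = c x - (M x : E →L[ℝ] E) w := by simp [hw]
      have h1 := norm_sub_le (c x) ((M x : E →L[ℝ] E) w)
      rw [← hzw] at h1
      have h2 := (M x : E →L[ℝ] E).le_opNorm w
      have h3 := mul_nonneg (norm_nonneg (c x)) (norm_nonneg w)
      have h4 := norm_nonneg (M x : E →L[ℝ] E)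
      simp only [A]
      linarith [h1, h2, h3, h4]
    have hD : ‖iteratedFDeriv ℝ l (φ.reflectDilate (M x) (c x)) z‖
        ≤ ‖iteratedFDeriv ℝ l φ w‖ * B x ^ l := by
      rw [iteratedFDeriv_reflectDilate, ← hw]
      simpa [B] using ContinuousMultilinearMap.norm_compContinuousLinearMap_le
        (iteratedFDeriv ℝ l φ w) fun _ => -((M x).symm : E →L[ℝ] E)
    calc ‖z‖ ^ k * ‖iteratedFDeriv ℝ l (φ.reflectDilate (M x) (c x)) z‖
        ≤ (A x * (1 + ‖w‖)) ^ k * (‖iteratedFDeriv ℝ l φ w‖ * B x ^ l) := by gcongr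
      _ = A x ^ k * B x ^ l * ((1 + ‖w‖) ^ k * ‖iteratedFDeriv ℝ l φ w‖) := by
        rw [mul_pow]
        ring
      _ ≤ A x ^ k * B x ^ l * m := by
        gcongr
        exact one_add_le_sup_seminorm_apply (𝕜 := ℝ) (m := (k, l)) le_rfl le_rfl φ w

/-- If the ellipsoid cover `Θ` is pointwise continuous (i.e. for every
`t` the map `x ↦ M_{x,t}` is continuous in operator norm), then for every tempered
distribution `f`, `N ≤ Ñ` and `λ > 0`, the superlevel set
`Ω = {x : M°_{N,Ñ} f(x) > λ}` of the radial grand maximal function is open. -/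
theorem stmt8 (n : ℕ) (Θ : EllipsoidCover n)
    (hpc : ∀ t : ℝ, Continuous fun x : Euc n => (Θ.M x t : Euc n →L[ℝ] Euc n))
    (N Nt : ℕ) (hNNt : N ≤ Nt) (f : SchwartzMap (Euc n) ℝ →L[ℝ] ℝ)
    (lam : ℝ) (hlam : 0 < lam) :
    IsOpen {x : Euc n | ENNReal.ofReal lam < Mrad Θ N Nt f x} := by
  rw [isOpen_iff_mem_nhds]
  intro x₀ hx₀
  obtain ⟨_, ⟨φ, ψ, t, hφ, hψ, rfl⟩, hlt⟩ := lt_sSup_iff.1 (mem_ofPred_eq ▸ hx₀)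
  set d : Euc n → ℝ :=
    fun x => |LinearMap.det ((Θ.M x t : Euc n →L[ℝ] Euc n) : Euc n →ₗ[ℝ] Euc n)|⁻¹
  set Ψ : Euc n → SchwartzMap (Euc n) ℝ := fun x => d x • φ.reflectDilate (Θ.M x t) x
  have hΨ : ∀ x z, Ψ x z = dilKer Θ φ x t x z := fun x z => by
    simp [Ψ, d, dilKer, SchwartzMap.reflectDilate_apply]
  have hψ₀ : ψ = Ψ x₀ := by
    ext z
    rw [hψ, hΨ]
  have hd : Continuous d := by
    have hdet : Continuous fun x => (Θ.M x t : Euc n →L[ℝ] Euc n).det :=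
      ContinuousLinearMap.continuous_det.comp (hpc t)
    exact hdet.abs.inv₀ fun x => abs_ne_zero.2
      (LinearEquiv.isUnit_det' (Θ.M x t).toLinearEquiv).ne_zero
  have hcont : Continuous fun x => ENNReal.ofReal |f (Ψ x)| :=
    ENNReal.continuous_ofReal.comp
      (f.continuous.comp (hd.smul (φ.continuous_reflectDilate _ _ (hpc t) continuous_id))).abs
  rw [hψ₀] at hlt
  filter_upwards [hcont.continuousAt.eventually (lt_mem_nhds hlt)] with x hx
  exact hx.trans_le (le_sSup ⟨φ, Ψ x, t, hφ, hΨ x, rfl⟩)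
end
end

section
/- Let Θ be a continuous ellipsoid cover of ℝⁿ with induced quasi-distance ρ_Θ, having quasi-triangle constant κ ≥ 1, and let K be a kernel satisfying the order-1 VASIO kernel estimate: K is C¹ in the second variable on {(x,y) : x ≠ y} and there is C₀ > 0 such that for all x ≠ y and |α| ≤ 1, |∂^α_v[K(x, M_{y,m}v)] evaluated at v = M_{y,m}⁻¹y| ≤ C₀/ρ_Θ(x,y), where m := −log₂ρ_Θ(x,y). Then there exist constants δ > 0 (one may take δ = a₆) and C > 0 such that for all x ≠ y: (1) |K(x,y)| ≤ C/ρ_Θ(x,y); (2) |K(x,y) − K(x,y')| ≤ C·[ρ_Θ(y,y')]^δ / [ρ_Θ(x,y)]^{1+δ} whenever ρ_Θ(y,y') ≤ ρ_Θ(x,y)/(2κ); and (3) K satisfies the Hörmander condition: for all y ∈ ℝⁿ, r > 0 and y' with ρ_Θ(y,y') < r, ∫_{{x : ρ_Θ(x,y) ≥ 2κr}} |K(x,y) − K(x,y')| dx ≤ C. -/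
open MeasureTheory Metric Set Filter ENNReal
noncomputable section

/-- The scale `m := −log₂ ρ_Θ(x,y)` associated to a pair of distinct points. -/
def EllipsoidCover.mExp {n : ℕ} (Θ : EllipsoidCover n) (x y : Euc n) : ℝ :=
  -(Real.logb 2 (Θ.ρ x y))

/-- The order-`s` VASIO kernel estimate with constant `C₀`: the kernel `K(x, ·)` is
`C^s` away from `x`, and for all `x ≠ y` and all multi-indices `|α| ≤ s` (encoded as
iterated directional derivatives along coordinate directions), the rescaled kernel
`v ↦ K(x, M_{y,m} v)`, `m = −log₂ ρ_Θ(x,y)`, satisfies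
`|∂^α_v [K(x, M_{y,m} v)]| ≤ C₀ / ρ_Θ(x,y)` at `v = M_{y,m}⁻¹ y`. -/
def KernelEst {n : ℕ} (Θ : EllipsoidCover n) (s : ℕ) (C₀ : ℝ)
    (K : Euc n → Euc n → ℝ) : Prop :=
  (∀ x : Euc n, ContDiffOn ℝ s (fun y => K x y) {y : Euc n | y ≠ x}) ∧
  ∀ x y : Euc n, x ≠ y → ∀ k : ℕ, k ≤ s → ∀ v : Fin k → Fin n,
    |iteratedFDerivWithin ℝ k (fun w => K x (Θ.M y (Θ.mExp x y) w))
        (⇑(Θ.M y (Θ.mExp x y)).symm '' {w : Euc n | w ≠ x})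
        ((Θ.M y (Θ.mExp x y)).symm y)
        (fun j => EuclideanSpace.single (v j) (1 : ℝ))| ≤ C₀ / Θ.ρ x y

open scoped Pointwise

namespace EllipsoidCover

variable {n : ℕ} (Θ : EllipsoidCover n)

theorem mem_θ {x c : Euc n} {t : ℝ} :
    x ∈ Θ.θ c t ↔ ∃ v : Euc n, ‖v‖ < 1 ∧ Θ.M c t v + c = x := by
  simp [θ]

theorem self_mem_θ (c : Euc n) (t : ℝ) : c ∈ Θ.θ c t :=
  Θ.mem_θ.2 ⟨0, by simp, by simp⟩

theorem convex_θ (c : Euc n) (t : ℝ) : Convex ℝ (Θ.θ c t) := by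
  have h := ((convex_ball (0 : Euc n) 1).linear_image
    (Θ.M c t).toLinearEquiv.toLinearMap).translate c
  rw [image_image] at h
  simp only [add_comm c] at h
  exact h

theorem exists_sub_eq_of_mem_θ {x y c : Euc n} {t : ℝ} (hx : x ∈ Θ.θ c t) (hy : y ∈ Θ.θ c t) :
    ∃ v : Euc n, ‖v‖ ≤ 2 ∧ x - y = Θ.M c t v := by
  obtain ⟨u, hu, rfl⟩ := Θ.mem_θ.1 hx
  obtain ⟨w, hw, rfl⟩ := Θ.mem_θ.1 hy
  refine ⟨u - w, (norm_sub_le u w).trans (by linarith), ?_⟩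
  rw [map_sub]
  abel

theorem norm_symm_apply_le_of_le {p a b : Euc n} {t t' : ℝ} (htt : t ≤ t')
    (ha : p ∈ Θ.θ a t) (hb : p ∈ Θ.θ b t') (v : Euc n) :
    ‖(Θ.M a t).symm (Θ.M b t' v)‖ ≤ Θ.a₅ * 2 ^ (-(Θ.a₆ * (t' - t))) * ‖v‖ := by
  obtain ⟨s, hs⟩ : ∃ s, t' = t + s := ⟨t' - t, by ring⟩
  subst hs
  have h := (Θ.shape a b t s (by linarith) ⟨p, ha, hb⟩).2.2
  rw [add_sub_cancel_left]
  exact ContinuousLinearMap.le_of_opNorm_le _ h v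

theorem norm_symm_apply_le_of_ge {p a b : Euc n} {t t' : ℝ} (htt : t ≤ t')
    (ha : p ∈ Θ.θ a t) (hb : p ∈ Θ.θ b t') (v : Euc n) :
    ‖(Θ.M b t').symm (Θ.M a t v)‖ ≤ Θ.a₃⁻¹ * 2 ^ (Θ.a₄ * (t' - t)) * ‖v‖ := by
  obtain ⟨s, hs⟩ : ∃ s, t' = t + s := ⟨t' - t, by ring⟩
  subst hs
  have h := (Θ.shape a b t s (by linarith) ⟨p, ha, hb⟩).1
  rw [add_sub_cancel_left]
  refine ContinuousLinearMap.le_of_opNorm_le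
    (((Θ.M b (t + s)).symm : Euc n →L[ℝ] Euc n).comp (Θ.M a t : Euc n →L[ℝ] Euc n)) ?_ v
  have hpos : 0 < Θ.a₃ * (2 : ℝ) ^ (-(Θ.a₄ * s)) := mul_pos Θ.ha₃ (by positivity)
  rw [one_div] at h
  have h' := inv_anti₀ hpos h
  rwa [inv_inv, mul_inv, Real.rpow_neg zero_le_two, inv_inv] at h'

theorem volume_θ_lb (c : Euc n) (t : ℝ) : Θ.a₁ * 2 ^ (-t) ≤ (volume (Θ.θ c t)).toReal :=
  Θ.volume_lb c t

theorem volume_θ_ub (c : Euc n) (t : ℝ) : (volume (Θ.θ c t)).toReal ≤ Θ.a₂ * 2 ^ (-t) :=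
  Θ.volume_ub c t

theorem volume_θ_ne_top (c : Euc n) (t : ℝ) : volume (Θ.θ c t) ≠ ⊤ := by
  intro h
  have h1 := Θ.volume_θ_lb c t
  rw [h, ENNReal.toReal_top] at h1
  have : 0 < Θ.a₁ * (2 : ℝ) ^ (-t) := mul_pos Θ.ha₁ (by positivity)
  linarith

theorem exists_rpow_neg_mul_lt {a C ε : ℝ} (ha : 0 < a) (hε : 0 < ε) :
    ∃ T : ℝ, 0 ≤ T ∧ ∀ t ≥ T, C * (2 : ℝ) ^ (-(a * t)) < ε := by
  have h1 : Tendsto (fun t : ℝ => (2 : ℝ) ^ (-(a * t))) atTop (nhds 0) :=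
    (tendsto_rpow_atBot_of_base_gt_one 2 one_lt_two).comp
      (tendsto_neg_atTop_atBot.comp (tendsto_id.const_mul_atTop ha))
  have h2 := h1.const_mul C
  rw [mul_zero] at h2
  obtain ⟨T, hT⟩ := ((h2.eventually_lt_const hε).and (eventually_ge_atTop 0)).exists_forall_of_atTop
  exact ⟨T, (hT T le_rfl).2, fun t ht => (hT t ht).1⟩

theorem exists_mem_θ (x y : Euc n) : ∃ t : ℝ, x ∈ Θ.θ x t ∧ y ∈ Θ.θ x t := by
  obtain ⟨T, hT0, hT⟩ := exists_rpow_neg_mul_lt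
    (C := Θ.a₅ * ‖(Θ.M x 0).symm (y - x)‖) Θ.ha₆ one_pos
  refine ⟨-T, Θ.self_mem_θ _ _, Θ.mem_θ.2 ⟨(Θ.M x (-T)).symm (y - x), ?_, by simp⟩⟩
  have h := Θ.norm_symm_apply_le_of_le (neg_nonpos.2 hT0) (Θ.self_mem_θ x _) (Θ.self_mem_θ x _)
    ((Θ.M x 0).symm (y - x))
  rw [ContinuousLinearEquiv.apply_symm_apply] at h
  have h2 := hT T le_rfl
  rw [zero_sub, neg_neg] at h
  linarith

theorem volumes_nonempty (x y : Euc n) :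
    {r : ℝ | ∃ (z : Euc n) (t : ℝ), x ∈ Θ.θ z t ∧ y ∈ Θ.θ z t ∧
      r = (volume (Θ.θ z t)).toReal}.Nonempty := by
  obtain ⟨t, h1, h2⟩ := Θ.exists_mem_θ x y
  exact ⟨_, x, t, h1, h2, rfl⟩

theorem ρ_le {x y c : Euc n} {t : ℝ} (hx : x ∈ Θ.θ c t) (hy : y ∈ Θ.θ c t) :
    Θ.ρ x y ≤ (volume (Θ.θ c t)).toReal :=
  csInf_le ⟨0, by rintro r ⟨_, _, _, _, rfl⟩; exact ENNReal.toReal_nonneg⟩ ⟨c, t, hx, hy, rfl⟩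

theorem exists_mem_θ_of_ρ_lt {x y : Euc n} {R : ℝ} (h : Θ.ρ x y < R) :
    ∃ (c : Euc n) (t : ℝ), x ∈ Θ.θ c t ∧ y ∈ Θ.θ c t ∧ Θ.a₁ * 2 ^ (-t) < R := by
  obtain ⟨_, ⟨c, t, hx, hy, rfl⟩, hr⟩ := exists_lt_of_csInf_lt (Θ.volumes_nonempty x y) h
  exact ⟨c, t, hx, hy, (Θ.volume_θ_lb c t).trans_lt hr⟩

theorem le_ρ {x y : Euc n} {R : ℝ}
    (h : ∀ c t, x ∈ Θ.θ c t → y ∈ Θ.θ c t → R ≤ (volume (Θ.θ c t)).toReal) : R ≤ Θ.ρ x y :=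
  le_csInf (Θ.volumes_nonempty x y) (by rintro _ ⟨c, t, hx, hy, rfl⟩; exact h c t hx hy)

theorem ρ_nonneg (x y : Euc n) : 0 ≤ Θ.ρ x y :=
  Θ.le_ρ fun _ _ _ _ => ENNReal.toReal_nonneg

theorem ρ_comm (x y : Euc n) : Θ.ρ x y = Θ.ρ y x :=
  le_antisymm (Θ.le_ρ fun _ _ hx hy => Θ.ρ_le hy hx) (Θ.le_ρ fun _ _ hx hy => Θ.ρ_le hy hx)

theorem ρ_self (x : Euc n) : Θ.ρ x x = 0 := by
  refine le_antisymm (le_of_forall_pos_le_add fun ε hε => ?_) (Θ.ρ_nonneg x x)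
  obtain ⟨T, -, hT⟩ := exists_rpow_neg_mul_lt (C := Θ.a₂) one_pos hε
  have h1 := hT T le_rfl
  rw [one_mul] at h1
  have h2 := Θ.ρ_le (Θ.self_mem_θ x T) (Θ.self_mem_θ x T)
  linarith [Θ.volume_θ_ub x T]

theorem ρ_pos {x y : Euc n} (hxy : x ≠ y) : 0 < Θ.ρ x y := by
  have hpos : 0 < ‖(Θ.M x 0).symm (y - x)‖ := by
    rw [norm_pos_iff, Ne, EmbeddingLike.map_eq_zero_iff, sub_eq_zero]
    exact hxy.symm
  obtain ⟨T, hT0, hT⟩ := exists_rpow_neg_mul_lt (C := Θ.a₅ * 2) Θ.ha₆ hpos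
  have hb : 0 < Θ.a₁ * (2 : ℝ) ^ (-T) := mul_pos Θ.ha₁ (by positivity)
  refine hb.trans_le (not_lt.1 fun hlt => ?_)
  obtain ⟨c, t, hx, hy, ht⟩ := Θ.exists_mem_θ_of_ρ_lt hlt
  have ht' : T < t := by
    have := lt_of_mul_lt_mul_left ht Θ.ha₁.le
    rw [Real.rpow_lt_rpow_left_iff one_lt_two] at this
    linarith
  obtain ⟨v, hv, hsub⟩ := Θ.exists_sub_eq_of_mem_θ hy hx
  have h1 := Θ.norm_symm_apply_le_of_le (hT0.trans ht'.le) (Θ.self_mem_θ x 0) hx v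
  rw [← hsub, sub_zero] at h1
  have h2 := hT t ht'.le
  have h3 : Θ.a₅ * 2 ^ (-(Θ.a₆ * t)) * ‖v‖ ≤ Θ.a₅ * 2 ^ (-(Θ.a₆ * t)) * 2 :=
    mul_le_mul_of_nonneg_left hv (mul_nonneg Θ.ha₅.le (by positivity))
  linarith

theorem ρ_le_of_mem_segment {y y' z : Euc n} (hz : z ∈ segment ℝ y y') :
    Θ.ρ y z ≤ Θ.ρ y y' :=
  Θ.le_ρ fun c t hy hy' => Θ.ρ_le hy ((Θ.convex_θ c t).segment_subset hy hy' hz)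

/-- The volume of a `ρ`-ball is at most a constant times its radius. -/
theorem volume_ρ_lt_le (y : Euc n) {R : ℝ} (hR : 0 < R) :
    volume {x | Θ.ρ x y < R} ≤ ENNReal.ofReal ((3 * Θ.a₅) ^ n * (Θ.a₂ / Θ.a₁) * R) := by
  have ha₁ := Θ.ha₁
  have ha₅ := Θ.ha₅
  set t₀ : ℝ := -Real.logb 2 (R / Θ.a₁) with ht₀
  have hpow : (2 : ℝ) ^ (-t₀) = R / Θ.a₁ := by
    rw [ht₀, neg_neg, Real.rpow_logb two_pos (by norm_num) (by positivity)]
  have hsub : {x | Θ.ρ x y < R} ⊆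
      (fun x => y + x) '' ((3 * Θ.a₅) • ((fun x => -y + x) '' Θ.θ y t₀)) := by
    intro x hx
    obtain ⟨c, t, hxc, hyc, ht⟩ := Θ.exists_mem_θ_of_ρ_lt hx
    have htt : t₀ ≤ t := by
      have h1 : (2 : ℝ) ^ (-t) < 2 ^ (-t₀) := by
        rw [hpow, lt_div_iff₀ ha₁]; linarith
      rw [Real.rpow_lt_rpow_left_iff one_lt_two] at h1
      linarith
    obtain ⟨v, hv, hsub⟩ := Θ.exists_sub_eq_of_mem_θ hxc hyc
    have h1 := Θ.norm_symm_apply_le_of_le htt (Θ.self_mem_θ y t₀) hyc v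
    rw [← hsub] at h1
    have h2 : (2 : ℝ) ^ (-(Θ.a₆ * (t - t₀))) ≤ 1 :=
      Real.rpow_le_one_of_one_le_of_nonpos one_le_two
        (neg_nonpos.2 (mul_nonneg Θ.ha₆.le (by linarith)))
    have h3 : ‖(Θ.M y t₀).symm (x - y)‖ < 3 * Θ.a₅ := by
      calc _ ≤ _ := h1
        _ ≤ Θ.a₅ * 1 * 2 := by gcongr
        _ < _ := by linarith
    refine ⟨x - y, Set.mem_smul_set.2 ⟨(3 * Θ.a₅)⁻¹ • (x - y), ?_, ?_⟩, by simp⟩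
    · refine ⟨(3 * Θ.a₅)⁻¹ • (x - y) + y, Θ.mem_θ.2
        ⟨(3 * Θ.a₅)⁻¹ • (Θ.M y t₀).symm (x - y), ?_, by simp⟩, by simp [add_comm]⟩
      rw [norm_smul, Real.norm_of_nonneg (by positivity), inv_mul_lt_iff₀ (by positivity)]
      linarith
    · rw [smul_inv_smul₀ (by positivity)]
  calc volume {x | Θ.ρ x y < R}
      ≤ volume ((fun x => y + x) '' ((3 * Θ.a₅) • ((fun x => -y + x) '' Θ.θ y t₀))) :=
        measure_mono hsub
    _ = ENNReal.ofReal ((3 * Θ.a₅) ^ n) * volume (Θ.θ y t₀) := by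
        rw [image_add_left, measure_preimage_add, Measure.addHaar_smul, image_add_left,
          measure_preimage_add, finrank_euclideanSpace_fin, abs_of_nonneg (by positivity)]
    _ ≤ ENNReal.ofReal ((3 * Θ.a₅) ^ n) * ENNReal.ofReal (Θ.a₂ / Θ.a₁ * R) := by
        gcongr
        rw [← ENNReal.ofReal_toReal (Θ.volume_θ_ne_top y t₀)]
        apply ENNReal.ofReal_le_ofReal
        refine (Θ.volume_θ_ub y t₀).trans (le_of_eq ?_)
        rw [hpow]
        ring
    _ = _ := by
        rw [← ENNReal.ofReal_mul (by positivity), mul_assoc]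

end EllipsoidCover

theorem ContinuousLinearMap.abs_apply_le_of_single {n : ℕ} (L : Euc n →L[ℝ] ℝ) {B : ℝ}
    (hB : ∀ i, |L (EuclideanSpace.single i 1)| ≤ B) (v : Euc n) : |L v| ≤ n * B * ‖v‖ := by
  have hv : v = ∑ i, v i • EuclideanSpace.single i (1 : ℝ) := by
    conv_lhs => rw [← (EuclideanSpace.basisFun (Fin n) ℝ).sum_repr v]
    simp
  calc |L v| = |∑ i, v i * L (EuclideanSpace.single i 1)| := by
        conv_lhs => rw [hv]
        simp
    _ ≤ ∑ i, |v i * L (EuclideanSpace.single i 1)| := Finset.abs_sum_le_sum_abs _ _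
    _ ≤ ∑ _i : Fin n, ‖v‖ * B := by
        refine Finset.sum_le_sum fun i _ => ?_
        rw [abs_mul]
        exact mul_le_mul (PiLp.norm_apply_le v i) (hB i) (abs_nonneg _) (norm_nonneg _)
    _ = n * B * ‖v‖ := by simp; ring

namespace KernelEst

variable {n : ℕ} {Θ : EllipsoidCover n} {C₀ : ℝ} {K : Euc n → Euc n → ℝ}

theorem abs_le {s : ℕ} (hK : KernelEst Θ s C₀ K) {x y : Euc n} (hxy : x ≠ y) :
    |K x y| ≤ C₀ / Θ.ρ x y := by
  simpa using hK.2 x y hxy 0 (Nat.zero_le _) Fin.elim0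

theorem differentiableAt (hK : KernelEst Θ 1 C₀ K) {x z : Euc n} (hxz : x ≠ z) :
    DifferentiableAt ℝ (K x) z :=
  ((hK.1 x).differentiableOn (by simp)).differentiableAt (isOpen_ne.mem_nhds hxz.symm)

theorem abs_fderiv_apply_le (hK : KernelEst Θ 1 C₀ K) {x z : Euc n} (hxz : x ≠ z) (u : Euc n) :
    |fderiv ℝ (K x) z u| ≤ n * (C₀ / Θ.ρ x z) * ‖(Θ.M z (Θ.mExp x z)).symm u‖ := by
  set M := Θ.M z (Θ.mExp x z)
  have hopen : IsOpen (M.symm '' {w : Euc n | w ≠ x}) :=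
    M.symm.toHomeomorph.isOpenMap _ isOpen_ne
  have hmem : M.symm z ∈ M.symm '' {w : Euc n | w ≠ x} := mem_image_of_mem _ hxz.symm
  have hL : fderiv ℝ (fun w => K x (M w)) (M.symm z) =
      (fderiv ℝ (K x) z).comp (M : Euc n →L[ℝ] Euc n) := by
    have h : HasFDerivAt (K x) (fderiv ℝ (K x) z) (M (M.symm z)) := by
      rw [M.apply_symm_apply]
      exact (hK.differentiableAt hxz).hasFDerivAt
    exact (h.comp (M.symm z) M.hasFDerivAt).fderiv
  have hB : ∀ i, |((fderiv ℝ (K x) z).comp (M : Euc n →L[ℝ] Euc n))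
      (EuclideanSpace.single i 1)| ≤ C₀ / Θ.ρ x z := by
    intro i
    have h := hK.2 x z hxz 1 le_rfl (fun _ => i)
    rwa [iteratedFDerivWithin_one_apply (hopen.uniqueDiffWithinAt hmem),
      fderivWithin_of_isOpen hopen hmem, hL] at h
  simpa using ContinuousLinearMap.abs_apply_le_of_single _ hB (M.symm u)

end KernelEst

namespace EllipsoidCover

variable {n : ℕ} (Θ : EllipsoidCover n)

theorem rpow_neg_mExp {x z : Euc n} (hxz : x ≠ z) : (2 : ℝ) ^ (-Θ.mExp x z) = Θ.ρ x z := by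
  rw [mExp, neg_neg, Real.rpow_logb two_pos (by norm_num) (Θ.ρ_pos hxz)]

/-- Two points at `ρ`-distance at most `ρ x z` are close in the metric of the ellipsoid
centred at `z` of scale `mExp x z`, if `z` lies on the segment joining them. -/
theorem norm_symm_sub_le {x y y' z : Euc n} (hxz : x ≠ z) (hyy : y ≠ y')
    (hz : z ∈ segment ℝ y y') (hle : Θ.ρ y y' ≤ Θ.ρ x z) :
    ‖(Θ.M z (Θ.mExp x z)).symm (y' - y)‖ ≤
      2 * (Θ.a₅ + Θ.a₃⁻¹ * (2 / Θ.a₁) ^ Θ.a₄) * (2 / Θ.a₁) ^ Θ.a₆ *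
        (Θ.ρ y y' / Θ.ρ x z) ^ Θ.a₆ := by
  have ha₁ := Θ.ha₁
  have ha₃ := Θ.ha₃
  have ha₄ := Θ.ha₄
  have ha₅ := Θ.ha₅
  have ha₆ := Θ.ha₆
  have hρ := Θ.ρ_pos hyy
  have hσ := Θ.ρ_pos hxz
  set m := Θ.mExp x z
  obtain ⟨c, t, hy, hy', ht⟩ := Θ.exists_mem_θ_of_ρ_lt (show Θ.ρ y y' < 2 * Θ.ρ y y' by linarith)
  have hzc := (Θ.convex_θ c t).segment_subset hy hy' hz
  obtain ⟨v, hv, hsub⟩ := Θ.exists_sub_eq_of_mem_θ hy' hy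
  set r := 2 / Θ.a₁ * (Θ.ρ y y' / Θ.ρ x z) with hr
  have hr0 : 0 < r := by positivity
  have hrR : r ≤ 2 / Θ.a₁ :=
    mul_le_of_le_one_right (by positivity) ((div_le_one hσ).2 hle)
  have hq : (2 : ℝ) ^ (m - t) ≤ r := by
    have h1 : (2 : ℝ) ^ (m - t) = 2 ^ (-t) / Θ.ρ x z := by
      rw [← Θ.rpow_neg_mExp hxz, ← Real.rpow_sub two_pos]
      congr 1
      ring
    have h2 : (2 : ℝ) ^ (-t) ≤ 2 / Θ.a₁ * Θ.ρ y y' := by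
      rw [div_mul_eq_mul_div, le_div_iff₀ ha₁]; linarith
    rw [h1, hr, ← mul_div_assoc]
    gcongr
  have hbound : ‖(Θ.M z m).symm (y' - y)‖ ≤
      (Θ.a₅ + Θ.a₃⁻¹ * (2 / Θ.a₁) ^ Θ.a₄) * r ^ Θ.a₆ * 2 := by
    rw [hsub]
    rcases le_total m t with hmt | htm
    · have h1 := Θ.norm_symm_apply_le_of_le hmt (Θ.self_mem_θ z m) hzc v
      have h2 : (2 : ℝ) ^ (-(Θ.a₆ * (t - m))) ≤ r ^ Θ.a₆ := by
        rw [show -(Θ.a₆ * (t - m)) = (m - t) * Θ.a₆ by ring, Real.rpow_mul zero_le_two]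
        exact Real.rpow_le_rpow (by positivity) hq ha₆.le
      refine h1.trans ?_
      have h3 : 0 ≤ Θ.a₃⁻¹ * (2 / Θ.a₁) ^ Θ.a₄ := by positivity
      gcongr
      linarith
    · have h1 := Θ.norm_symm_apply_le_of_ge htm hzc (Θ.self_mem_θ z m) v
      have h2 : (2 : ℝ) ^ (Θ.a₄ * (m - t)) ≤ (2 / Θ.a₁) ^ Θ.a₄ := by
        rw [mul_comm, Real.rpow_mul zero_le_two]
        exact Real.rpow_le_rpow (by positivity) (hq.trans hrR) ha₄.le
      have h3 : 1 ≤ r ^ Θ.a₆ := by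
        refine Real.one_le_rpow (le_trans ?_ hq) ha₆.le
        exact Real.one_le_rpow one_le_two (by linarith)
      refine h1.trans ?_
      have h4 : Θ.a₃⁻¹ * (2 : ℝ) ^ (Θ.a₄ * (m - t)) ≤
          (Θ.a₅ + Θ.a₃⁻¹ * (2 / Θ.a₁) ^ Θ.a₄) * r ^ Θ.a₆ := by
        calc _ ≤ Θ.a₃⁻¹ * (2 / Θ.a₁) ^ Θ.a₄ := by gcongr
          _ ≤ Θ.a₅ + Θ.a₃⁻¹ * (2 / Θ.a₁) ^ Θ.a₄ := by linarith
          _ ≤ _ := le_mul_of_one_le_right (by positivity) h3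
      gcongr
  refine hbound.trans (le_of_eq ?_)
  rw [hr, Real.mul_rpow (by positivity) (by positivity)]
  ring

end EllipsoidCover

namespace KernelEst

variable {n : ℕ} {Θ : EllipsoidCover n} {C₀ κ : ℝ} {K : Euc n → Euc n → ℝ}

theorem exists_holder (hK : KernelEst Θ 1 C₀ K) (hC₀ : 0 < C₀) (hκ : 1 ≤ κ)
    (htri : ∀ x y z : Euc n, Θ.ρ x y ≤ κ * (Θ.ρ x z + Θ.ρ z y)) :
    ∃ C : ℝ, 0 ≤ C ∧ ∀ x y y' : Euc n, x ≠ y → Θ.ρ y y' ≤ Θ.ρ x y / (2 * κ) →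
      |K x y - K x y'| ≤ C * (Θ.ρ y y') ^ Θ.a₆ / (Θ.ρ x y) ^ (1 + Θ.a₆) := by
  have ha₁ := Θ.ha₁
  have ha₃ := Θ.ha₃
  have ha₅ := Θ.ha₅
  have ha₆ := Θ.ha₆
  set D := 2 * (Θ.a₅ + Θ.a₃⁻¹ * (2 / Θ.a₁) ^ Θ.a₄) * (2 / Θ.a₁) ^ Θ.a₆
  have hD0 : 0 ≤ D := by positivity
  refine ⟨n * C₀ * D * (2 * κ) ^ (1 + Θ.a₆), by positivity, fun x y y' hxy hle => ?_⟩
  have hρ := Θ.ρ_pos hxy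
  rcases eq_or_ne y y' with rfl | hyy
  · simp [Θ.ρ_self, Real.zero_rpow ha₆.ne']
  have hρy := Θ.ρ_pos hyy
  have hlow : ∀ z ∈ segment ℝ y y', Θ.ρ x y / (2 * κ) ≤ Θ.ρ x z := by
    intro z hz
    have h1 := Θ.ρ_le_of_mem_segment hz
    have h2 := htri x y z
    rw [Θ.ρ_comm z y] at h2
    rw [le_div_iff₀ (by positivity)] at hle
    rw [div_le_iff₀ (by positivity)]
    nlinarith
  have hne : ∀ z ∈ segment ℝ y y', x ≠ z := by
    rintro z hz rfl
    have h1 := hlow x hz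
    rw [Θ.ρ_self] at h1
    have : 0 < Θ.ρ x y / (2 * κ) := by positivity
    linarith
  set B := n * C₀ * D * (2 * κ) ^ (1 + Θ.a₆) * (Θ.ρ y y') ^ Θ.a₆ / (Θ.ρ x y) ^ (1 + Θ.a₆) with hB
  have hderiv : ∀ z ∈ segment ℝ y y', |fderiv ℝ (K x) z (y' - y)| ≤ B := by
    intro z hz
    have hσ := Θ.ρ_pos (hne z hz)
    have h1 := hK.abs_fderiv_apply_le (hne z hz) (y' - y)
    have h2 := Θ.norm_symm_sub_le (hne z hz) hyy hz (hle.trans (hlow z hz))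
    calc _ ≤ _ := h1
      _ ≤ n * (C₀ / Θ.ρ x z) * (D * (Θ.ρ y y' / Θ.ρ x z) ^ Θ.a₆) := by gcongr
      _ = n * C₀ * D * (Θ.ρ y y') ^ Θ.a₆ / (Θ.ρ x z) ^ (1 + Θ.a₆) := by
        rw [Real.div_rpow hρy.le hσ.le, Real.rpow_add hσ, Real.rpow_one]
        field_simp
      _ ≤ n * C₀ * D * (Θ.ρ y y') ^ Θ.a₆ / (Θ.ρ x y / (2 * κ)) ^ (1 + Θ.a₆) := by
        gcongr
        exact hlow z hz
      _ = B := by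
        rw [hB, Real.div_rpow hρ.le (by positivity)]
        field_simp
  have hseg : ∀ τ ∈ Icc (0 : ℝ) 1, y + τ • (y' - y) ∈ segment ℝ y y' := by
    intro τ hτ
    rw [segment_eq_image']
    exact ⟨τ, hτ, rfl⟩
  have hmv := norm_image_sub_le_of_norm_deriv_le_segment_01'
    (f := fun τ : ℝ => K x (y + τ • (y' - y)))
    (f' := fun τ => fderiv ℝ (K x) (y + τ • (y' - y)) (y' - y)) (C := B)
    (fun τ hτ => by
      have hline : HasDerivAt (fun τ : ℝ => y + τ • (y' - y)) (y' - y) τ := by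
        simpa using ((hasDerivAt_id τ).smul_const (y' - y)).const_add y
      exact ((hK.differentiableAt (hne _ (hseg τ hτ))).hasFDerivAt.comp_hasDerivAt τ
        hline).hasDerivWithinAt)
    (fun τ hτ => hderiv _ (hseg τ (Ico_subset_Icc_self hτ)))
  rw [abs_sub_comm]
  simpa using hmv

theorem lintegral_le_of_holder {δ C : ℝ} (hδ : 0 < δ) (hC : 0 ≤ C) (hκ : 1 ≤ κ)
    (hH : ∀ x y y' : Euc n, x ≠ y → Θ.ρ y y' ≤ Θ.ρ x y / (2 * κ) →
      |K x y - K x y'| ≤ C * (Θ.ρ y y') ^ δ / (Θ.ρ x y) ^ (1 + δ))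
    (y y' : Euc n) {r : ℝ} (hr : 0 < r) (hyr : Θ.ρ y y' < r) :
    ∫⁻ x in {x : Euc n | 2 * κ * r ≤ Θ.ρ x y}, ENNReal.ofReal |K x y - K x y'| ≤
      ENNReal.ofReal (2 * C * ((3 * Θ.a₅) ^ n * (Θ.a₂ / Θ.a₁)) * (1 - 2 ^ (-δ))⁻¹) := by
  have ha₁ := Θ.ha₁
  have ha₂ := Θ.ha₂
  have ha₅ := Θ.ha₅
  set E := (3 * Θ.a₅) ^ n * (Θ.a₂ / Θ.a₁)
  have hE0 : 0 < E := by positivity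
  set R : ℕ → ℝ := fun k => 2 * κ * r * 2 ^ k with hR
  have hRpos : ∀ k, 0 < R k := fun k => by positivity
  have hcover : {x : Euc n | 2 * κ * r ≤ Θ.ρ x y} ⊆
      ⋃ k : ℕ, {x | R k ≤ Θ.ρ x y ∧ Θ.ρ x y < R (k + 1)} := by
    intro x hx
    have hx' : 1 ≤ Θ.ρ x y / (2 * κ * r) := (one_le_div (by positivity)).2 hx
    obtain ⟨k, hk1, hk2⟩ := exists_nat_pow_near hx' one_lt_two
    rw [le_div_iff₀ (by positivity)] at hk1
    rw [div_lt_iff₀ (by positivity)] at hk2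
    exact mem_iUnion.2 ⟨k, by simpa only [hR, mul_comm] using hk1,
      by simpa only [hR, mul_comm] using hk2⟩
  have hshell : ∀ k : ℕ, ∫⁻ x in {x | R k ≤ Θ.ρ x y ∧ Θ.ρ x y < R (k + 1)},
      ENNReal.ofReal |K x y - K x y'| ≤ ENNReal.ofReal (2 * C * E * (2 ^ (-δ)) ^ k) := by
    intro k
    have hpt : ∀ x ∈ {x | R k ≤ Θ.ρ x y ∧ Θ.ρ x y < R (k + 1)},
        ENNReal.ofReal |K x y - K x y'| ≤ ENNReal.ofReal (C * r ^ δ / R k ^ (1 + δ)) := by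
      rintro x ⟨hx, -⟩
      have h2r : 2 * κ * r ≤ R k :=
        le_mul_of_one_le_right (by positivity) (one_le_pow₀ one_le_two)
      have hxy : x ≠ y := by
        rintro rfl
        rw [Θ.ρ_self] at hx
        linarith [hRpos k]
      apply ENNReal.ofReal_le_ofReal
      refine (hH x y y' hxy ?_).trans ?_
      · rw [le_div_iff₀ (by positivity)]
        nlinarith
      · have h0 := Θ.ρ_nonneg y y'
        have h1 := hRpos k
        gcongr
    calc _ ≤ ∫⁻ _ in {x | R k ≤ Θ.ρ x y ∧ Θ.ρ x y < R (k + 1)},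
          ENNReal.ofReal (C * r ^ δ / R k ^ (1 + δ)) := setLIntegral_mono measurable_const hpt
      _ ≤ ENNReal.ofReal (C * r ^ δ / R k ^ (1 + δ)) * ENNReal.ofReal (E * R (k + 1)) := by
        rw [setLIntegral_const]
        gcongr
        exact (measure_mono fun x hx => hx.2).trans (Θ.volume_ρ_lt_le y (hRpos _))
      _ = ENNReal.ofReal (C * r ^ δ / R k ^ (1 + δ) * (E * R (k + 1))) := by
        have h1 := hRpos k
        rw [← ENNReal.ofReal_mul (by positivity)]
      _ ≤ _ := by
        apply ENNReal.ofReal_le_ofReal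
        have h1 := hRpos k
        have h2 : R (k + 1) = 2 * R k := by simp only [hR, pow_succ]; ring
        have h3 : C * r ^ δ / R k ^ (1 + δ) * (E * R (k + 1)) = 2 * C * E * (r / R k) ^ δ := by
          rw [h2, Real.rpow_add h1, Real.rpow_one, Real.div_rpow hr.le h1.le]
          field_simp
        have h4 : r / R k ≤ (2 ^ k)⁻¹ := by
          rw [div_le_iff₀ h1, hR]
          have : (2 ^ k : ℝ)⁻¹ * (2 * κ * r * 2 ^ k) = 2 * κ * r := by field_simp
          rw [this]
          nlinarith
        have h5 : ((2 : ℝ) ^ (-δ)) ^ k = ((2 ^ k)⁻¹) ^ δ := by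
          rw [Real.inv_rpow (by positivity), ← Real.rpow_natCast, ← Real.rpow_natCast,
            ← Real.rpow_mul zero_le_two, ← Real.rpow_mul zero_le_two,
            ← Real.rpow_neg zero_le_two]
          congr 1
          ring
        rw [h3, h5]
        gcongr
  have hq1 : (2 : ℝ) ^ (-δ) < 1 :=
    Real.rpow_lt_one_of_one_lt_of_neg one_lt_two (neg_lt_zero.2 hδ)
  have hq0 : (0 : ℝ) ≤ 2 ^ (-δ) := by positivity
  calc _ ≤ ∫⁻ x in ⋃ k : ℕ, {x | R k ≤ Θ.ρ x y ∧ Θ.ρ x y < R (k + 1)},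
        ENNReal.ofReal |K x y - K x y'| := lintegral_mono_set hcover
    _ ≤ ∑' k : ℕ, ∫⁻ x in {x | R k ≤ Θ.ρ x y ∧ Θ.ρ x y < R (k + 1)},
        ENNReal.ofReal |K x y - K x y'| := lintegral_iUnion_le _ _
    _ ≤ ∑' k : ℕ, ENNReal.ofReal (2 * C * E * (2 ^ (-δ)) ^ k) := ENNReal.tsum_le_tsum hshell
    _ = ENNReal.ofReal (∑' k : ℕ, 2 * C * E * (2 ^ (-δ)) ^ k) :=
        (ENNReal.ofReal_tsum_of_nonneg (fun k => by positivity)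
          ((summable_geometric_of_lt_one hq0 hq1).mul_left _)).symm
    _ = _ := by rw [tsum_mul_left, tsum_geometric_of_lt_one hq0 hq1]

end KernelEst

/-- If `K` satisfies the order-1 VASIO kernel estimate with respect to
a continuous ellipsoid cover `Θ` whose quasi-distance `ρ_Θ` has quasi-triangle constant
`κ ≥ 1`, then there are `δ, C > 0` such that for all `x ≠ y`:
`|K(x,y)| ≤ C/ρ_Θ(x,y)`;
`|K(x,y) − K(x,y')| ≤ C ρ_Θ(y,y')^δ / ρ_Θ(x,y)^{1+δ}` whenever
`ρ_Θ(y,y') ≤ ρ_Θ(x,y)/(2κ)`; and `K` satisfies the Hörmander condition. -/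
theorem stmt10 (n : ℕ) (Θ : EllipsoidCover n) (κ : ℝ) (hκ : 1 ≤ κ)
    (htri : ∀ x y z : Euc n, Θ.ρ x y ≤ κ * (Θ.ρ x z + Θ.ρ z y))
    (K : Euc n → Euc n → ℝ) (C₀ : ℝ) (hC₀ : 0 < C₀) (hK : KernelEst Θ 1 C₀ K) :
    ∃ δ C : ℝ, 0 < δ ∧ 0 < C ∧
      (∀ x y : Euc n, x ≠ y → |K x y| ≤ C / Θ.ρ x y) ∧
      (∀ x y y' : Euc n, x ≠ y → Θ.ρ y y' ≤ Θ.ρ x y / (2 * κ) →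
        |K x y - K x y'| ≤ C * (Θ.ρ y y') ^ δ / (Θ.ρ x y) ^ (1 + δ)) ∧
      (∀ (y y' : Euc n) (r : ℝ), 0 < r → Θ.ρ y y' < r →
        ∫⁻ x in {x : Euc n | 2 * κ * r ≤ Θ.ρ x y}, ENNReal.ofReal |K x y - K x y'| ≤
          ENNReal.ofReal C) := by
  obtain ⟨C₁, hC₁, hH⟩ := hK.exists_holder hC₀ hκ htri
  have hI := fun y y' r hr hyr =>
    KernelEst.lintegral_le_of_holder Θ.ha₆ hC₁ hκ hH y y' (r := r) hr hyr
  set C₂ := 2 * C₁ * ((3 * Θ.a₅) ^ n * (Θ.a₂ / Θ.a₁)) * (1 - 2 ^ (-Θ.a₆))⁻¹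
  have hC₁' : C₁ ≤ max C₀ (max C₁ C₂) := (le_max_left _ _).trans (le_max_right _ _)
  have hC₂' : C₂ ≤ max C₀ (max C₁ C₂) := (le_max_right _ _).trans (le_max_right _ _)
  refine ⟨Θ.a₆, max C₀ (max C₁ C₂), Θ.ha₆, lt_max_of_lt_left hC₀, fun x y hxy => ?_,
    fun x y y' hxy hle => ?_, fun y y' r hr hyr => ?_⟩
  · exact (hK.abs_le hxy).trans (div_le_div_of_nonneg_right (le_max_left _ _) (Θ.ρ_nonneg x y))
  · have h1 := Θ.ρ_nonneg y y'
    have h2 := Θ.ρ_nonneg x y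
    exact (hH x y y' hxy hle).trans (by gcongr)
  · exact (hI y y' r hr hyr).trans (ENNReal.ofReal_le_ofReal hC₂')
end
end

section
/- Let l ∈ ℕ₀ and n ∈ ℕ. Then there exists a constant C > 0 depending only on l and n such that for every ellipsoid θ = M(𝔹ⁿ) + z ⊆ ℝⁿ (M an invertible n×n matrix, z ∈ ℝⁿ) and every f ∈ L¹(θ), the unique polynomial π_θf of degree ≤ l in n variables satisfying ∫_θ π_θf(x)Q(x)dx = ∫_θ f(x)Q(x)dx for all polynomials Q of degree ≤ l satisfies sup_{x∈θ} |π_θf(x)| ≤ (C/|θ|) ∫_θ |f(x)| dx. -/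
open MeasureTheory Metric Set
noncomputable section

/-- Substituting polynomials of degree at most one does not increase the total degree. -/
theorem MvPolynomial.totalDegree_bind₁_le {σ τ R : Type*} [CommSemiring R]
    (g : σ → MvPolynomial τ R) (hg : ∀ i, (g i).totalDegree ≤ 1) (P : MvPolynomial σ R) :
    (MvPolynomial.bind₁ g P).totalDegree ≤ P.totalDegree := by
  rw [MvPolynomial.bind₁, MvPolynomial.aeval_def, MvPolynomial.eval₂_eq]
  refine MvPolynomial.totalDegree_finsetSum_le fun d hd => ?_
  refine (MvPolynomial.totalDegree_mul _ _).trans ?_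
  rw [MvPolynomial.algebraMap_eq, MvPolynomial.totalDegree_C, zero_add]
  refine (MvPolynomial.totalDegree_finsetProd _ _).trans (le_trans ?_
    (MvPolynomial.le_totalDegree hd))
  refine Finset.sum_le_sum fun i _ => (MvPolynomial.totalDegree_pow _ _).trans ?_
  exact (Nat.mul_le_mul_left _ (hg i)).trans_eq (mul_one _)

/-- Polynomials pull back along affine maps to polynomials of no larger degree. -/
theorem MvPolynomial.exists_eval_affine {m n : ℕ}
    (M : EuclideanSpace ℝ (Fin m) →ₗ[ℝ] EuclideanSpace ℝ (Fin n)) (z : EuclideanSpace ℝ (Fin n))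
    (P : MvPolynomial (Fin n) ℝ) :
    ∃ Q : MvPolynomial (Fin m) ℝ, Q.totalDegree ≤ P.totalDegree ∧
      ∀ y : EuclideanSpace ℝ (Fin m), MvPolynomial.eval (fun i => y i) Q =
        MvPolynomial.eval (fun i => (M y + z) i) P := by
  let g : Fin n → MvPolynomial (Fin m) ℝ := fun i =>
    (∑ j, MvPolynomial.C (M (EuclideanSpace.single j 1) i) * MvPolynomial.X j) +
      MvPolynomial.C (z i)
  have hg : ∀ i, (g i).totalDegree ≤ 1 := fun i => by
    refine (MvPolynomial.totalDegree_add _ _).trans (max_le ?_ (by simp))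
    refine MvPolynomial.totalDegree_finsetSum_le fun j _ => ?_
    refine (MvPolynomial.totalDegree_mul _ _).trans ?_
    simp
  refine ⟨MvPolynomial.bind₁ g P, MvPolynomial.totalDegree_bind₁_le g hg P, fun y => ?_⟩
  rw [MvPolynomial.eval, MvPolynomial.eval₂Hom_bind₁]
  congr 2
  funext i
  have hy : y = ∑ j, y j • EuclideanSpace.single j (1 : ℝ) := by
    ext k
    simp [Finset.sum_apply, Pi.single_apply]
  conv_rhs => rw [hy]
  simp [g, mul_comm]

/-- The volume on a closed unit ball charges its nonempty relatively open subsets. -/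
theorem isOpenPosMeasure_closedBall {n : ℕ} :
    (volume.comap
      (Subtype.val : closedBall (0 : EuclideanSpace ℝ (Fin n)) 1 → _)).IsOpenPosMeasure := by
  refine ⟨fun U hU ⟨x, hx⟩ => ?_⟩
  obtain ⟨O, hO, rfl⟩ := isOpen_induced_iff.1 hU
  have hcl : (x : EuclideanSpace ℝ (Fin n)) ∈ closure (ball 0 1) := by
    rw [closure_ball _ one_ne_zero]
    exact x.2
  have hne : (O ∩ ball 0 1).Nonempty := mem_closure_iff.1 hcl O hO hx
  have hpos := (hO.inter isOpen_ball).measure_pos volume hne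
  rw [(MeasurableEmbedding.subtype_coe measurableSet_closedBall).comap_preimage, Subtype.range_coe]
  refine (hpos.trans_le (measure_mono ?_)).ne'
  exact inter_subset_inter_right _ ball_subset_closedBall

/-- On polynomials of bounded degree, the supremum norm on the unit ball is controlled by the
`L²` norm. -/
theorem exists_sq_eval_le_integral_ball (l n : ℕ) :
    ∃ K : ℝ, 0 < K ∧ ∀ P : MvPolynomial (Fin n) ℝ, P.totalDegree ≤ l →
      ∀ x ∈ closedBall (0 : EuclideanSpace ℝ (Fin n)) 1,
        MvPolynomial.eval (fun i => x i) P ^ 2 ≤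
          K * ∫ y in ball (0 : EuclideanSpace ℝ (Fin n)) 1,
            MvPolynomial.eval (fun i => y i) P ^ 2 := by
  let B := closedBall (0 : EuclideanSpace ℝ (Fin n)) 1
  have : CompactSpace B := isCompact_iff_compactSpace.1 (isCompact_closedBall _ _)
  let μ : Measure B := volume.comap Subtype.val
  have : IsFiniteMeasure μ := ⟨by
    rw [← preimage_univ (f := ((↑) : B → EuclideanSpace ℝ (Fin n))),
      (MeasurableEmbedding.subtype_coe measurableSet_closedBall).comap_preimage, univ_inter,
      Subtype.range_coe]
    exact measure_closedBall_lt_top⟩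
  have : μ.IsOpenPosMeasure := isOpenPosMeasure_closedBall
  let T : MvPolynomial (Fin n) ℝ →ₗ[ℝ] C(B, ℝ) :=
    { toFun := fun P => ⟨fun x => MvPolynomial.eval (fun i => x.1 i) P,
        (MvPolynomial.continuous_eval P).comp (by fun_prop)⟩
      map_add' := fun P Q => by ext; simp
      map_smul' := fun c P => by ext; simp }
  let W := (MvPolynomial.restrictTotalDegree (Fin n) ℝ l).map T
  let S : W →ₗ[ℝ] Lp ℝ 2 μ :=
    (ContinuousMap.toLp 2 μ ℝ : C(B, ℝ) →L[ℝ] Lp ℝ 2 μ).toLinearMap ∘ₗ W.subtype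
  have hS : LinearMap.ker S = ⊥ := LinearMap.ker_eq_bot.2
    ((ContinuousMap.toLp_injective μ).comp Subtype.val_injective)
  obtain ⟨K, hK, hanti⟩ :=
    LinearMap.exists_antilipschitzWith (𝕜 := ℝ) (E := W) (F := Lp ℝ 2 μ) S hS
  refine ⟨(K : ℝ) ^ 2, by positivity, fun P hP x hx => ?_⟩
  let w : W := ⟨T P, Submodule.mem_map_of_mem
    ((MvPolynomial.mem_restrictTotalDegree _ _ _).2 hP)⟩
  have hbound : ‖T P‖ ≤ K * ‖S w‖ := by
    simpa using hanti.le_mul_dist w 0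
  have hnorm : ‖S w‖ ^ 2 = ∫ y in ball (0 : EuclideanSpace ℝ (Fin n)) 1,
      MvPolynomial.eval (fun i => y i) P ^ 2 := by
    have hae : (ball (0 : EuclideanSpace ℝ (Fin n)) 1 : Set _) =ᵐ[volume] closedBall 0 1 :=
      ball_subset_closedBall.eventuallyLE.antisymm (by
        rw [ae_le_set, closedBall_sdiff_ball]
        exact Measure.addHaar_sphere_of_ne_zero _ _ one_ne_zero)
    rw [← real_inner_self_eq_norm_sq, setIntegral_congr_set hae,
      ← integral_subtype_comap measurableSet_closedBall]
    refine (ContinuousMap.inner_toLp μ (T P) (T P)).trans ?_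
    refine integral_congr_ae (.of_forall fun y => ?_)
    simp [T, sq]
  calc MvPolynomial.eval (fun i => x i) P ^ 2 = ‖T P ⟨x, hx⟩‖ ^ 2 := by simp [T]
    _ ≤ (K * ‖S w‖) ^ 2 := by
      gcongr
      exact ((T P).norm_coe_le_norm _).trans hbound
    _ = _ := by rw [mul_pow, hnorm]

/-- Change of variables for the image of a set under an invertible affine map. -/
theorem setIntegral_image_affine {n : ℕ}
    (M : EuclideanSpace ℝ (Fin n) ≃L[ℝ] EuclideanSpace ℝ (Fin n)) (z : EuclideanSpace ℝ (Fin n))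
    {s : Set (EuclideanSpace ℝ (Fin n))} (hs : MeasurableSet s)
    (g : EuclideanSpace ℝ (Fin n) → ℝ) :
    ∫ x in (fun y => M y + z) '' s, g x =
      |(M : EuclideanSpace ℝ (Fin n) →L[ℝ] EuclideanSpace ℝ (Fin n)).det| *
        ∫ y in s, g (M y + z) := by
  rw [integral_image_eq_integral_abs_det_fderiv_smul volume hs
    (fun x _ => ((M.hasFDerivAt (x := x)).add_const z).hasFDerivWithinAt)
    (fun x _ y _ h => M.injective (add_right_cancel h))]
  simp only [smul_eq_mul, integral_const_mul]

/-- For every `l ∈ ℕ₀` and `n ∈ ℕ` there is a constant `C > 0`,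
depending only on `l` and `n`, such that for every ellipsoid `θ = M(𝔹ⁿ) + z`
(`M` invertible) and every `f ∈ L¹(θ)`, the polynomial `P` of total degree `≤ l`
matching the moments of `f` against all polynomials of total degree `≤ l` on `θ`
(i.e. `P = π_θ f`) satisfies `sup_{x ∈ θ} |P(x)| ≤ (C/|θ|) ∫_θ |f|`. -/
theorem stmt14 (l n : ℕ) :
    ∃ C : ℝ, 0 < C ∧
      ∀ (M : EuclideanSpace ℝ (Fin n) ≃L[ℝ] EuclideanSpace ℝ (Fin n))
        (z : EuclideanSpace ℝ (Fin n)) (f : EuclideanSpace ℝ (Fin n) → ℝ),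
        IntegrableOn f ((fun y => M y + z) '' ball 0 1) volume →
        ∀ P : MvPolynomial (Fin n) ℝ, P.totalDegree ≤ l →
        (∀ Q : MvPolynomial (Fin n) ℝ, Q.totalDegree ≤ l →
          ∫ x in (fun y => M y + z) '' ball 0 1,
              (MvPolynomial.eval (fun i => x i) P) * (MvPolynomial.eval (fun i => x i) Q) =
            ∫ x in (fun y => M y + z) '' ball 0 1,
              f x * (MvPolynomial.eval (fun i => x i) Q)) →
        ∀ x ∈ (fun y => M y + z) '' ball 0 1,
          |MvPolynomial.eval (fun i => x i) P| ≤
            (C / (volume ((fun y => M y + z) '' ball 0 1)).toReal) *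
              ∫ y in (fun y => M y + z) '' ball 0 1, |f y| := by
  obtain ⟨K, hK, hsup⟩ := exists_sq_eval_le_integral_ball l n
  let V := volume.real (ball (0 : EuclideanSpace ℝ (Fin n)) 1)
  have hV : 0 < V := ENNReal.toReal_pos (measure_ball_pos _ _ one_pos).ne'
    measure_ball_lt_top.ne
  refine ⟨K * V, by positivity, fun M z f hf P hP hmom => ?_⟩
  set θ := (fun y => M y + z) '' ball 0 1 with hθ
  let D := |(M : EuclideanSpace ℝ (Fin n) →L[ℝ] EuclideanSpace ℝ (Fin n)).det|
  have hD : 0 < D := abs_pos.2 (LinearEquiv.isUnit_det' M.toLinearEquiv).ne_zero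
  have hvol : (volume θ).toReal = D * V := by
    simpa [Measure.real, D, V] using
      setIntegral_image_affine M z (measurableSet_ball (x := 0) (ε := 1)) fun _ => 1
  obtain ⟨Q, hQP, hQ⟩ := MvPolynomial.exists_eval_affine
    (M : EuclideanSpace ℝ (Fin n) →ₗ[ℝ] EuclideanSpace ℝ (Fin n)) z P
  have hQ' : ∀ y, MvPolynomial.eval (fun i => y i) Q =
      MvPolynomial.eval (fun i => (M y + z) i) P := hQ
  have hcont : Continuous fun y : EuclideanSpace ℝ (Fin n) =>
      |MvPolynomial.eval (fun i => y i) Q| :=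
    ((MvPolynomial.continuous_eval Q).comp (by fun_prop)).abs
  obtain ⟨y₀, hy₀, hmax⟩ := (isCompact_closedBall (0 : EuclideanSpace ℝ (Fin n)) 1).exists_isMaxOn
    ⟨0, by simp⟩ hcont.continuousOn
  let s := |MvPolynomial.eval (fun i => y₀ i) Q|
  have hle : ∀ x ∈ θ, |MvPolynomial.eval (fun i => x i) P| ≤ s := by
    rintro _ ⟨y, hy, rfl⟩
    rw [← hQ' y]
    exact hmax (ball_subset_closedBall hy)
  have hθm : MeasurableSet θ := by
    have hopen : IsOpenMap fun y => M y + z := (isOpenMap_add_right z).comp M.isOpenMap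
    exact (hopen _ isOpen_ball).measurableSet
  let I := ∫ y in θ, |f y|
  have hI : 0 ≤ I := integral_nonneg fun _ => abs_nonneg _
  have hsq : D * ∫ y in ball (0 : EuclideanSpace ℝ (Fin n)) 1,
      MvPolynomial.eval (fun i => y i) Q ^ 2 ≤ I * s := by
    calc _ = ∫ x in θ, f x * MvPolynomial.eval (fun i => x i) P := by
          rw [← hmom P hP, hθ, setIntegral_image_affine M z measurableSet_ball]
          simp only [hQ', sq, D]
      _ ≤ ‖∫ x in θ, f x * MvPolynomial.eval (fun i => x i) P‖ := Real.le_norm_self _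
      _ ≤ ∫ x in θ, |f x| * s := by
          refine norm_integral_le_of_norm_le (hf.abs.mul_const s) ?_
          filter_upwards [ae_restrict_mem hθm] with x hx
          rw [norm_mul, Real.norm_eq_abs, Real.norm_eq_abs]
          exact mul_le_mul_of_nonneg_left (hle x hx) (abs_nonneg _)
      _ = I * s := integral_mul_const _ _
  have hs : s ≤ K * I / D := by
    have hs0 : 0 ≤ s := abs_nonneg _
    rcases hs0.eq_or_lt with h0 | h0
    · rw [← h0]
      positivity
    · rw [le_div_iff₀ hD]
      have hbound := hsup Q (hQP.trans hP) y₀ hy₀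
      rw [← sq_abs] at hbound
      refine le_of_mul_le_mul_right ?_ h0
      calc s * D * s = D * s ^ 2 := by ring
        _ ≤ D * (K * ∫ y in ball (0 : EuclideanSpace ℝ (Fin n)) 1,
              MvPolynomial.eval (fun i => y i) Q ^ 2) :=
            mul_le_mul_of_nonneg_left hbound hD.le
        _ = K * (D * ∫ y in ball (0 : EuclideanSpace ℝ (Fin n)) 1,
              MvPolynomial.eval (fun i => y i) Q ^ 2) := by ring
        _ ≤ K * (I * s) := mul_le_mul_of_nonneg_left hsq hK.le
        _ = K * I * s := by ring
  intro x hx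
  rw [hvol]
  refine (hle x hx).trans (hs.trans_eq ?_)
  change _ = K * V / (D * V) * I
  field_simp
end
end
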